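/- Let G be a locally (soluble-by-finite) group with the property K̄. Then the second derived subgroup ⁅⁅G,G⁆,⁅G,G⁆⁆ of G is finite. -/

import Mathlib

/-- A group `G` has property K̄ if for every subgroup `X` of `G` the set of
subgroups of the form `⁅X, H⁆`, with `H` ranging over subgroups of `G`, is finite. -/
def PropK (G : Type*) [Group G] : Prop :=
  ∀ X : Subgroup G, {S : Subgroup G | ∃ H : Subgroup G, S = ⁅X, H⁆}.Finite

/-- A group is locally (soluble-by-finite) if every finitely generated subgroup
contains a solvable subgroup of finite index. -/
def LocallySolubleByFinite (G : Type*) [Group G] : Prop :=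
  ∀ S : Subgroup G, S.FG → ∃ T : Subgroup S, IsSolvable T ∧ T.FiniteIndex


section
open scoped commutatorElement


theorem field_fin (K : Type*) [Field K] [Module.Finite ℤ K] : Finite K := by
  by_cases hinj : Function.Injective (algebraMap ℤ K)
  · have : Algebra.IsIntegral ℤ K := inferInstance
    exact absurd (isField_of_isIntegral_of_isField hinj (Field.toIsField K)) Int.not_isField
  · rw [injective_iff_map_eq_zero] at hinj
    push Not at hinj
    obtain ⟨n, hn, hn0⟩ := hinj
    apply Module.finite_of_fg_torsion K
    intro x
    refine ⟨⟨n, mem_nonZeroDivisors_of_ne_zero hn0⟩, ?_⟩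
    change n • x = 0
    rw [Algebra.smul_def, hn, zero_mul]

theorem int_jac : IsJacobsonRing ℤ := by
  rw [isJacobsonRing_iff_prime_eq]
  intro P hP
  by_cases h : P = ⊥
  · subst h
    rw [eq_bot_iff]
    intro n hn
    have := Ideal.mem_jacobson_bot.1 hn n
    rw [Int.isUnit_iff] at this
    rw [Ideal.mem_bot]
    have h0 : 0 ≤ n * n := mul_self_nonneg n
    have : n * n = 0 := by omega
    exact mul_self_eq_zero.1 this
  · have := hP.isMaximal h
    exact Ideal.jacobson_eq_self_of_isMaximal

theorem simple_fin (R : Type*) [CommRing R] [Algebra.FiniteType ℤ R] (M : Type*) [AddCommGroup M]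
    [Module R M] [IsSimpleModule R M] : Finite M := by
  obtain ⟨I, hI, ⟨e⟩⟩ := isSimpleModule_iff_quot_maximal.1 (inferInstance : IsSimpleModule R M)
  let : Field (R ⧸ I) := Ideal.Quotient.field I
  have : Algebra.FiniteType ℤ (R ⧸ I) := inferInstance
  have := int_jac
  have : Module.Finite ℤ (R ⧸ I) := finite_of_finite_type_of_isJacobsonRing ℤ (R ⧸ I)
  have : Finite (R ⧸ I) := field_fin _
  exact Finite.of_equiv _ e.symm.toEquiv

theorem finlen_fin (R : Type*) [CommRing R] [Algebra.FiniteType ℤ R] (M : Type*) [AddCommGroup M]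
    [Module R M] (h : IsFiniteLength R M) : Finite M := by
  induction h with
  | of_subsingleton => infer_instance
  | @of_simple_quotient M _ _ N _ _ ih =>
    have : Finite (M ⧸ N) := simple_fin R _
    have : Finite N.toAddSubgroup := ih
    have : Finite (M ⧸ N.toAddSubgroup) := ‹Finite (M ⧸ N)›
    exact Finite.of_equiv _ (AddSubgroup.addGroupEquivQuotientProdAddSubgroup (s := N.toAddSubgroup)).symm

theorem mod_fin (R : Type*) [CommRing R] [Algebra.FiniteType ℤ R] (M : Type*) [AddCommGroup M]
    [Module R M] [Finite (Submodule R M)] : Finite M :=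
  finlen_fin R M (isFiniteLength_iff_isNoetherian_isArtinian.2
    ⟨⟨fun N => by
      have : WellFoundedGT (Submodule R M) := inferInstance
      exact (isNoetherian_iff'.2 this).noetherian N⟩, inferInstanceAs (WellFoundedLT (Submodule R M))⟩)

theorem comm_fin (M : Type*) [CommGroup M] (σ : MulAut M)
    (h : {N : Subgroup M | ∀ k : ℤ, ∀ n ∈ N, (σ ^ k) n ∈ N}.Finite) : Finite M := by
  let : MulDistribMulAction (Multiplicative ℤ) M :=
    MulDistribMulAction.compHom M (zpowersHom (MulAut M) σ)
  let ρ := Representation.ofMulDistribMulAction (Multiplicative ℤ) M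
  have h1 : Finite (Submodule (MonoidAlgebra ℤ (Multiplicative ℤ)) ρ.asModule) := by
    let f : Submodule (MonoidAlgebra ℤ (Multiplicative ℤ)) ρ.asModule →
        {N : Subgroup M | ∀ k : ℤ, ∀ n ∈ N, (σ ^ k) n ∈ N} := fun N =>
      ⟨AddSubgroup.toSubgroup' (N.toAddSubgroup : AddSubgroup (Additive M)), by
        intro k n hn
        let m : ρ.asModule := Additive.ofMul n
        have hn' : m ∈ N := hn
        have := N.smul_mem (MonoidAlgebra.of ℤ _ (Multiplicative.ofAdd k)) hn'
        let m' : ρ.asModule := Additive.ofMul ((σ ^ k) n)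
        change m' ∈ N
        have h5 : m' = (MonoidAlgebra.of ℤ _ (Multiplicative.ofAdd k)) • m := by
          change _ = ρ.asAlgebraHom (MonoidAlgebra.of ℤ _ (Multiplicative.ofAdd k)) _
          rw [Representation.asAlgebraHom_of]
          rfl
        rw [h5]
        exact this⟩
    have := h.to_subtype
    apply Finite.of_injective f
    intro N₁ N₂ h
    have h2 := congrArg Subtype.val h
    ext x
    exact (SetLike.ext_iff.1 h2 (Additive.toMul (x : Additive M)))
  have hfg : Monoid.FG (Multiplicative ℤ) := Group.fg_iff_monoid_fg.1 inferInstance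
  have h3 : @Algebra.FiniteType ℤ (MonoidAlgebra ℤ (Multiplicative ℤ)) _ _ (Ring.toIntAlgebra _) := by
    convert! MonoidAlgebra.finiteType_of_fg (R := ℤ) (M := Multiplicative ℤ)
  exact mod_fin (MonoidAlgebra ℤ (Multiplicative ℤ)) ρ.asModule

theorem lemU {G : Type*} [Group G] (hG : PropK G) (x : G) (A D : Subgroup G)
    (hAc : ∀ a ∈ A, ∀ b ∈ A, a * b = b * a) (hcent : ∀ d ∈ D, ∀ a ∈ A, d * a = a * d)
    (hxD : ∀ d ∈ D, x * d * x⁻¹ ∈ D) (hxD' : ∀ d ∈ D, x⁻¹ * d * x ∈ D)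
    (hA : ∀ d ∈ D, ⁅x, d⁆ ∈ A) : {z | ∃ d ∈ D, ⁅x, d⁆ = z}.Finite := by
  have hmul : ∀ d ∈ D, ∀ e ∈ D, ⁅x, d * e⁆ = ⁅x, d⁆ * ⁅x, e⁆ := by
    intro d hd e he
    have h1 := hcent d hd _ (hA e he)
    have h2 : ⁅x, d * e⁆ = ⁅x, d⁆ * (d * ⁅x, e⁆ * d⁻¹) := by
      simp only [commutatorElement_def]; group
    rw [h2, h1]; group
  have hinv : ∀ d ∈ D, ⁅x, d⁻¹⁆ = ⁅x, d⁆⁻¹ := by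
    intro d hd
    have := hmul d hd d⁻¹ (D.inv_mem hd)
    rw [mul_inv_cancel, commutatorElement_one_right] at this
    exact (inv_eq_of_mul_eq_one_right this.symm).symm
  have hconj : ∀ d, x * ⁅x, d⁆ * x⁻¹ = ⁅x, x * d * x⁻¹⁆ := by
    intro d; simp only [commutatorElement_def]; group
  have hconj' : ∀ d, x⁻¹ * ⁅x, d⁆ * x = ⁅x, x⁻¹ * d * x⁆ := by
    intro d; simp only [commutatorElement_def]; group
  let M : Subgroup G :=
    { carrier := {z | ∃ d ∈ D, ⁅x, d⁆ = z}
      one_mem' := ⟨1, D.one_mem, commutatorElement_one_right x⟩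
      mul_mem' := by
        rintro _ _ ⟨d, hd, rfl⟩ ⟨e, he, rfl⟩
        exact ⟨d * e, D.mul_mem hd he, hmul d hd e he⟩
      inv_mem' := by
        rintro _ ⟨d, hd, rfl⟩
        exact ⟨d⁻¹, D.inv_mem hd, hinv d hd⟩ }
  have hMx : ∀ m ∈ M, x * m * x⁻¹ ∈ M := by
    rintro _ ⟨d, hd, rfl⟩
    exact ⟨_, hxD d hd, (hconj d).symm⟩
  have hMx' : ∀ m ∈ M, x⁻¹ * m * x ∈ M := by
    rintro _ ⟨d, hd, rfl⟩
    exact ⟨_, hxD' d hd, (hconj' d).symm⟩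
  let : CommGroup M :=
    { (inferInstance : Group M) with
      mul_comm := by
        rintro ⟨_, d, hd, rfl⟩ ⟨_, e, he, rfl⟩
        exact Subtype.ext (hAc _ (hA d hd) _ (hA e he)) }
  let σ : MulAut M :=
    { toFun := fun m => ⟨x * m * x⁻¹, hMx m m.2⟩
      invFun := fun m => ⟨x⁻¹ * m * x, hMx' m m.2⟩
      left_inv := fun m => Subtype.ext (by simp only; group)
      right_inv := fun m => Subtype.ext (by simp only; group)
      map_mul' := fun a b => Subtype.ext (by
        change x * (a * b : G) * x⁻¹ = (x * a * x⁻¹) * (x * b * x⁻¹)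
        group) }
  have hfin : {N : Subgroup M | ∀ k : ℤ, ∀ n ∈ N, (σ ^ k) n ∈ N}.Finite := by
    have hinj : Set.InjOn (fun N : Subgroup M => N.map M.subtype)
        {N : Subgroup M | ∀ k : ℤ, ∀ n ∈ N, (σ ^ k) n ∈ N} :=
      fun a _ b _ h => Subgroup.map_injective M.subtype_injective h
    refine Set.Finite.of_finite_image ((hG (Subgroup.zpowers x)).subset ?_) hinj
    rintro _ ⟨N, hN, rfl⟩
    have hN1 : ∀ n ∈ N.map M.subtype, x * n * x⁻¹ ∈ N.map M.subtype := by
      rintro _ ⟨n, hn, rfl⟩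
      exact ⟨_, hN 1 n hn, rfl⟩
    have hN2 : ∀ n ∈ N.map M.subtype, x⁻¹ * n * x ∈ N.map M.subtype := by
      rintro _ ⟨n, hn, rfl⟩
      exact ⟨_, hN (-1) n hn, rfl⟩
    have hNM : N.map M.subtype ≤ M := Subgroup.map_subtype_le N
    simp only
    generalize N.map M.subtype = P at hN1 hN2 hNM
    let B : Subgroup G :=
      { carrier := {d | d ∈ D ∧ ⁅x, d⁆ ∈ P}
        one_mem' := ⟨D.one_mem, by rw [commutatorElement_one_right]; exact P.one_mem⟩
        mul_mem' := by
          rintro d e ⟨hd, hd'⟩ ⟨he, he'⟩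
          exact ⟨D.mul_mem hd he, by rw [hmul d hd e he]; exact P.mul_mem hd' he'⟩
        inv_mem' := by
          rintro d ⟨hd, hd'⟩
          exact ⟨D.inv_mem hd, by rw [hinv d hd]; exact P.inv_mem hd'⟩ }
    refine ⟨B, le_antisymm ?_ ?_⟩
    · intro p hp
      obtain ⟨d, hd, rfl⟩ := hNM hp
      exact Subgroup.commutator_mem_commutator (Subgroup.mem_zpowers x) ⟨hd, hp⟩
    · rw [Subgroup.commutator_le]
      rintro _ ⟨k, rfl⟩ d ⟨hd, hd'⟩
      change ⁅x ^ k, d⁆ ∈ P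
      induction k with
      | zero => simp
      | succ k ih =>
        have : ⁅x ^ ((k : ℤ) + 1), d⁆ = (x * ⁅x ^ (k : ℤ), d⁆ * x⁻¹) * ⁅x, d⁆ := by
          rw [add_comm, zpow_one_add]
          simp only [commutatorElement_def]; group
        rw [this]
        exact P.mul_mem (hN1 _ ih) hd'
      | pred k ih =>
        have : ⁅x ^ (-(k : ℤ) - 1), d⁆ = (x⁻¹ * ⁅x ^ (-(k : ℤ)), d⁆ * x) * (x⁻¹ * ⁅x, d⁆⁻¹ * x) := by
          rw [sub_eq_add_neg, add_comm, zpow_add, zpow_neg_one]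
          simp only [commutatorElement_def]; group
        rw [this]
        exact P.mul_mem (hN2 _ ih) (hN2 _ (P.inv_mem hd'))
  have : Finite M := comm_fin M σ hfin
  exact Set.toFinite (M : Set G)

theorem fi_of {G α : Type*} [Group G] (H K : Subgroup G) (f : G → α) (s : Set α) (hs : s.Finite)
    (hf : ∀ g ∈ K, f g ∈ s)
    (h : ∀ g ∈ K, ∀ k ∈ K, f g = f k → g⁻¹ * k ∈ H) : H.relIndex K ≠ 0 := by
  have := hs.to_subtype
  have : Finite (K ⧸ H.subgroupOf K) := by
    apply Finite.of_injective (fun q : K ⧸ H.subgroupOf K => (⟨f q.out, hf _ q.out.2⟩ : s))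
    intro a b hab
    have h1 := h _ a.out.2 _ b.out.2 (congrArg Subtype.val hab)
    rw [← a.out_eq, ← b.out_eq]
    exact QuotientGroup.eq.2 h1
  exact Subgroup.index_ne_zero_of_finite (H := H.subgroupOf K)

theorem propK_sub {G : Type*} [Group G] (hG : PropK G) (S : Subgroup G) : PropK S := by
  intro X
  refine Set.Finite.of_finite_image ((hG (X.map S.subtype)).subset ?_)
    (f := fun N : Subgroup S => N.map S.subtype)
    (fun a _ b _ h => Subgroup.map_injective S.subtype_injective h)
  rintro _ ⟨_, ⟨H, rfl⟩, rfl⟩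
  exact ⟨H.map S.subtype, Subgroup.map_commutator _ _ _⟩

theorem propK_quot {G : Type*} [Group G] (hG : PropK G) (N : Subgroup G) [N.Normal] :
    PropK (G ⧸ N) := by
  intro X
  refine ((hG (X.comap (QuotientGroup.mk' N))).image
    (fun L => L.map (QuotientGroup.mk' N))).subset ?_
  rintro _ ⟨H, rfl⟩
  refine ⟨_, ⟨H.comap (QuotientGroup.mk' N), rfl⟩, ?_⟩
  simp only
  rw [Subgroup.map_commutator, Subgroup.map_comap_eq_self_of_surjective (QuotientGroup.mk'_surjective N),
    Subgroup.map_comap_eq_self_of_surjective (QuotientGroup.mk'_surjective N)]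

/-- every element has finitely many conjugates -/
def FCgrp (G : Type*) [Group G] : Prop := ∀ x : G, (Subgroup.centralizer {x}).index ≠ 0

theorem center_rel {G : Type*} [Group G] (hfg : Group.FG G) (A : Subgroup G)
    (h : ∀ x : G, (Subgroup.centralizer {x}).relIndex A ≠ 0) :
    (Subgroup.center G).relIndex A ≠ 0 := by
  obtain ⟨s, hs, hfin⟩ := Group.fg_iff.1 hfg
  have := hfin.to_subtype
  rw [Subgroup.center_eq_infi' hs]
  exact Subgroup.relIndex_iInf_ne_zero fun i => h i

theorem fc_step {S : Type*} [Group S] (hfg : Group.FG S) (hK : PropK S) (A : Subgroup S) [A.Normal]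
    (hAc : ∀ a ∈ A, ∀ b ∈ A, a * b = b * a) (hq : FCgrp (S ⧸ A)) : FCgrp S := by
  have key : ∀ {T : Type _} [Group T] (x g k : T), ⁅x, g⁆ = ⁅x, k⁆ → x * (g⁻¹ * k) = g⁻¹ * k * x := by
    intro T _ x g k h
    simp only [commutatorElement_def] at h
    have h2 : g * x⁻¹ * g⁻¹ = k * x⁻¹ * k⁻¹ := by
      have := congrArg (fun t => x⁻¹ * t) h
      simpa [mul_assoc] using this
    have h3 : x⁻¹ * (g⁻¹ * k) = g⁻¹ * k * x⁻¹ := by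
      calc x⁻¹ * (g⁻¹ * k) = g⁻¹ * (g * x⁻¹ * g⁻¹) * k := by group
        _ = g⁻¹ * (k * x⁻¹ * k⁻¹) * k := by rw [h2]
        _ = _ := by group
    calc x * (g⁻¹ * k) = x * (g⁻¹ * k * x⁻¹) * x := by group
      _ = x * (x⁻¹ * (g⁻¹ * k)) * x := by rw [h3]
      _ = _ := by group
  have h1 : ∀ x : S, (Subgroup.centralizer {x}).relIndex A ≠ 0 := by
    intro x
    have hfin := lemU hK x A A hAc hAc (fun d hd => ‹A.Normal›.conj_mem d hd x)
      (fun d hd => by simpa using ‹A.Normal›.conj_mem d hd x⁻¹)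
      (fun d hd => by
        rw [commutatorElement_def]
        exact A.mul_mem (‹A.Normal›.conj_mem d hd x) (A.inv_mem hd))
    refine fi_of _ _ (fun g => ⁅x, g⁆) _ hfin (fun g hg => ⟨g, hg, rfl⟩) ?_
    intro g _ k _ h
    rw [Subgroup.mem_centralizer_singleton_iff]
    first | exact key x g k h | exact (key x g k h).symm
  have h2 := center_rel hfg A h1
  intro x
  let Z := Subgroup.center S
  let D0 : Subgroup S := (Subgroup.centralizer {QuotientGroup.mk' Z x}).comap (QuotientGroup.mk' Z)
  let D : Subgroup S := (Subgroup.centralizer {QuotientGroup.mk' A x}).comap (QuotientGroup.mk' A)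
  have hDtop : D.relIndex ⊤ ≠ 0 := by
    rw [Subgroup.relIndex_top_right, Subgroup.index_comap_of_surjective _ (QuotientGroup.mk'_surjective A)]
    exact hq _
  have memq : ∀ (N : Subgroup S) [N.Normal] (g : S),
      QuotientGroup.mk' N g ∈ Subgroup.centralizer {QuotientGroup.mk' N x} ↔ ⁅x, g⁆ ∈ N := by
    intro N _ g
    rw [Subgroup.mem_centralizer_singleton_iff, ← QuotientGroup.eq_one_iff, eq_comm]
    change _ ↔ QuotientGroup.mk' N ⁅x, g⁆ = 1
    rw [map_commutatorElement, commutatorElement_eq_one_iff_mul_comm]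
  have hD0D : D0.relIndex D ≠ 0 := by
    have hfin : Finite (A.map (QuotientGroup.mk' Z)) := by
      apply Nat.finite_of_card_ne_zero
      rw [← Subgroup.relIndex_ker, QuotientGroup.ker_mk']
      exact h2
    refine fi_of _ _ (fun g => QuotientGroup.mk' Z ⁅x, g⁆) (A.map (QuotientGroup.mk' Z) : Set (S ⧸ Z))
      (Set.toFinite _) ?_ ?_
    · intro g hg
      exact ⟨_, (memq A g).1 hg, rfl⟩
    · intro g _ k _ h
      simp only [map_commutatorElement] at h
      have := key _ _ _ h
      rw [Subgroup.mem_comap, Subgroup.mem_centralizer_singleton_iff, map_mul, map_inv]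
      first | exact this | exact this.symm
  have hCD0 : (Subgroup.centralizer {x}).relIndex D0 ≠ 0 := by
    have hxD0 : x ∈ D0 := (memq Z x).2 (by rw [commutatorElement_self]; exact Z.one_mem)
    have hfin := lemU hK x Z D0 (fun a ha b _ => (Subgroup.mem_center_iff.1 ha b).symm)
      (fun d _ a ha => Subgroup.mem_center_iff.1 ha d)
      (fun d hd => D0.mul_mem (D0.mul_mem hxD0 hd) (D0.inv_mem hxD0))
      (fun d hd => D0.mul_mem (D0.mul_mem (D0.inv_mem hxD0) hd) hxD0)
      (fun d hd => (memq Z d).1 hd)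
    refine fi_of _ _ (fun g => ⁅x, g⁆) _ hfin (fun g hg => ⟨g, hg, rfl⟩) ?_
    intro g _ k _ h
    rw [Subgroup.mem_centralizer_singleton_iff]
    first | exact key x g k h | exact (key x g k h).symm
  rw [← Subgroup.relIndex_top_right]
  exact Subgroup.relIndex_ne_zero_trans hCD0 (Subgroup.relIndex_ne_zero_trans hD0D hDtop)

/-- derived series of a subgroup, inside the whole group -/
def der {G : Type*} [Group G] (N : Subgroup G) : ℕ → Subgroup G
  | 0 => N
  | n + 1 => ⁅der N n, der N n⁆

theorem der_normal {G : Type*} [Group G] (N : Subgroup G) [hN : N.Normal] (n : ℕ) :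
    (der N n).Normal := by
  induction n with
  | zero => exact hN
  | succ n ih => exact Subgroup.commutator_normal _ _

theorem der_map {G H : Type*} [Group G] [Group H] (f : G →* H) (N : Subgroup G) (n : ℕ) :
    (der N n).map f = der (N.map f) n := by
  induction n with
  | zero => rfl
  | succ n ih => simp only [der]; rw [Subgroup.map_commutator, ih]

theorem der_mono {G : Type*} [Group G] {N M : Subgroup G} (h : N ≤ M) (n : ℕ) :
    der N n ≤ der M n := by
  induction n with
  | zero => exact h
  | succ n ih => exact Subgroup.commutator_mono ih ih

theorem der_top (G : Type*) [Group G] (n : ℕ) : der (⊤ : Subgroup G) n = derivedSeries G n := by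
  induction n with
  | zero => rfl
  | succ n ih => simp only [der]; rw [ih, derivedSeries_succ]

theorem fc_of_der (n : ℕ) : ∀ (S : Type*) [Group S], Group.FG S → PropK S → ∀ N : Subgroup S,
    N.Normal → N.FiniteIndex → der N n = ⊥ → FCgrp S := by
  induction n with
  | zero =>
    intro S _ _ _ N _ hfi hN x
    change N = ⊥ at hN
    subst hN
    have h := hfi.index_ne_zero
    intro h0
    exact h (by
      have := Subgroup.index_dvd_of_le (bot_le : ⊥ ≤ Subgroup.centralizer {x})
      rw [h0] at this
      exact zero_dvd_iff.1 this)
  | succ n ih =>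
    intro S _ hfg hK N hN hfi hder
    have hA := der_normal N n
    apply fc_step hfg hK (der N n)
    · intro a ha b hb
      have : ⁅a, b⁆ ∈ ⁅der N n, der N n⁆ := Subgroup.commutator_mem_commutator ha hb
      change ⁅der N n, der N n⁆ = ⊥ at hder
      rw [hder, Subgroup.mem_bot] at this
      exact commutatorElement_eq_one_iff_mul_comm.1 this
    · refine ih (S ⧸ der N n) inferInstance (propK_quot hK _)
        (N.map (QuotientGroup.mk' _)) (hN.map _ (QuotientGroup.mk'_surjective _)) ⟨?_⟩ ?_
      · intro h0
        have := Subgroup.index_map_dvd N (QuotientGroup.mk'_surjective (der N n))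
        rw [h0] at this
        exact hfi.index_ne_zero (zero_dvd_iff.1 this)
      · rw [← der_map, QuotientGroup.map_mk'_self]

theorem fg_comm_fin {G : Type*} [Group G] (hloc : LocallySolubleByFinite G) (hG : PropK G)
    (S : Subgroup G) (hS : S.FG) : Finite (⁅S, S⁆ : Subgroup G) := by
  obtain ⟨T, ⟨n, hn⟩, hT⟩ := hloc S hS
  have hfg : Group.FG S := (Group.fg_iff_subgroup_fg S).2 hS
  have hder : der T n = ⊥ := by
    have h1 := der_map T.subtype ⊤ n
    rw [der_top, hn, Subgroup.map_bot] at h1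
    rw [h1, ← MonoidHom.range_eq_map, Subgroup.range_subtype]
  have hfc : FCgrp S := fc_of_der n S hfg (propK_sub hG S) T.normalCore inferInstance inferInstance
    (eq_bot_iff.2 (hder ▸ der_mono (Subgroup.normalCore_le T) n))
  have hc := center_rel hfg ⊤ (fun x => by rw [Subgroup.relIndex_top_right]; exact hfc x)
  rw [Subgroup.relIndex_top_right] at hc
  have : (Subgroup.center S).FiniteIndex := ⟨hc⟩
  have hcs : Finite (commutatorSet S) := by
    apply Set.Finite.to_subtype
    refine (Set.finite_range (fun p : (S ⧸ Subgroup.center S) × (S ⧸ Subgroup.center S) =>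
      ⁅p.1.out, p.2.out⁆)).subset ?_
    rintro _ ⟨g, h, rfl⟩
    refine ⟨(QuotientGroup.mk g, QuotientGroup.mk h), ?_⟩
    obtain ⟨z, hz⟩ := QuotientGroup.mk_out_eq_mul (Subgroup.center S) g
    obtain ⟨w, hw⟩ := QuotientGroup.mk_out_eq_mul (Subgroup.center S) h
    simp only [hz, hw]
    have hz' := fun t => Subgroup.mem_center_iff.1 z.2 t
    have hw' := fun t => Subgroup.mem_center_iff.1 w.2 t
    simp only [commutatorElement_def, mul_inv_rev]
    calc g * z * (h * w) * ((z : S)⁻¹ * g⁻¹) * ((w : S)⁻¹ * h⁻¹)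
        = g * (z * (h * w)) * ((z : S)⁻¹ * g⁻¹) * ((w : S)⁻¹ * h⁻¹) := by group
      _ = g * h * (w * g⁻¹) * ((w : S)⁻¹ * h⁻¹) := by rw [← hz']; group
      _ = _ := by rw [← hw']; group
  have hcomm : Finite (commutator S) := inferInstance
  have h3 : ⁅S, S⁆ = (commutator S).map S.subtype := by
    rw [commutator_def, Subgroup.map_commutator, ← MonoidHom.range_eq_map, Subgroup.range_subtype]
  rw [h3]
  exact Set.Finite.to_subtype (Set.Finite.image _ (Set.toFinite (commutator S : Set S)))

theorem comm_finite {G : Type*} [Group G] (hloc : LocallySolubleByFinite G) (hG : PropK G) (x : G) :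
    {z | ∃ h : G, ⁅h, x⁆ = z}.Finite := by
  refine (((hG (Subgroup.zpowers x)).subset
    (t := {L | ∃ h : G, L = ⁅Subgroup.zpowers x, Subgroup.zpowers h⁆}) ?_).biUnion
    (t := fun L => (L : Set G)) ?_).subset ?_
  · rintro _ ⟨h, rfl⟩
    exact ⟨_, rfl⟩
  · rintro _ ⟨h, rfl⟩
    have hf := fg_comm_fin hloc hG (Subgroup.zpowers x ⊔ Subgroup.zpowers h)
      (Subgroup.FG.sup (⟨{x}, by simp [Subgroup.zpowers_eq_closure]⟩)
        (⟨{h}, by simp [Subgroup.zpowers_eq_closure]⟩))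
    exact (Set.toFinite ((⁅Subgroup.zpowers x ⊔ Subgroup.zpowers h,
      Subgroup.zpowers x ⊔ Subgroup.zpowers h⁆ : Subgroup G) : Set G)).subset
      (SetLike.coe_subset_coe.2 (Subgroup.commutator_mono le_sup_left le_sup_right))
  · rintro _ ⟨h, rfl⟩
    refine Set.mem_biUnion (x := ⁅Subgroup.zpowers x, Subgroup.zpowers h⁆) ⟨h, rfl⟩ ?_
    rw [← commutatorElement_inv]
    exact Subgroup.inv_mem _ (Subgroup.commutator_mem_commutator (Subgroup.mem_zpowers x) (Subgroup.mem_zpowers h))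

theorem comm_zpowers {G : Type*} [Group G] (x : G) :
    ⁅(⊤ : Subgroup G), Subgroup.zpowers x⁆ ≤ Subgroup.closure {z | ∃ h : G, ⁅h, x⁆ = z} := by
  set P := Subgroup.closure {z | ∃ h : G, ⁅h, x⁆ = z} with hP
  have h0 : ∀ h, ⁅h, x⁆ ∈ P := fun h => Subgroup.subset_closure ⟨h, rfl⟩
  have hn : P.Normal := by
    refine ⟨fun n hn g => ?_⟩
    induction hn using Subgroup.closure_induction with
    | mem z hz =>
      obtain ⟨h, rfl⟩ := hz
      have : g * ⁅h, x⁆ * g⁻¹ = ⁅g * h, x⁆ * ⁅g, x⁆⁻¹ := by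
        simp only [commutatorElement_def]; group
      rw [this]
      exact P.mul_mem (h0 _) (P.inv_mem (h0 _))
    | one => simp
    | mul a b _ _ iha ihb =>
      have : g * (a * b) * g⁻¹ = (g * a * g⁻¹) * (g * b * g⁻¹) := by group
      rw [this]
      exact P.mul_mem iha ihb
    | inv a _ iha =>
      have : g * a⁻¹ * g⁻¹ = (g * a * g⁻¹)⁻¹ := by group
      rw [this]
      exact P.inv_mem iha
  have hc : ∀ g : G, QuotientGroup.mk' P g * QuotientGroup.mk' P x =
      QuotientGroup.mk' P x * QuotientGroup.mk' P g := by
    intro g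
    rw [← commutatorElement_eq_one_iff_mul_comm, ← map_commutatorElement]
    exact (QuotientGroup.eq_one_iff _).2 (h0 g)
  rw [Subgroup.commutator_le]
  rintro g - _ ⟨k, rfl⟩
  rw [← QuotientGroup.eq_one_iff]
  change QuotientGroup.mk' P ⁅g, x ^ k⁆ = 1
  rw [map_commutatorElement, map_zpow, commutatorElement_eq_one_iff_commute]
  exact Commute.zpow_right (hc g) k

theorem stmt_7 (G : Type*) [Group G] (hloc : LocallySolubleByFinite G)
    (hG : PropK G) : Finite (⁅commutator G, commutator G⁆ : Subgroup G) := by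
  let I : Set (Subgroup G) := {L | ∃ h : G, L = ⁅(⊤ : Subgroup G), Subgroup.zpowers h⁆}
  have hI : I.Finite := (hG ⊤).subset (by rintro _ ⟨h, rfl⟩; exact ⟨_, rfl⟩)
  choose! r hr using fun (L : Subgroup G) (hL : L ∈ I) => hL
  let W : Set G := ⋃ L ∈ I, {z | ∃ h : G, ⁅h, r L⁆ = z}
  have hW : W.Finite := hI.biUnion fun L _ => comm_finite hloc hG (r L)
  have hW2 : ∀ z ∈ W, ∃ p : G × G, ⁅p.1, p.2⁆ = z := by
    intro z hz
    simp only [W, Set.mem_iUnion] at hz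
    obtain ⟨L, hL, h, rfl⟩ := hz
    exact ⟨(h, r L), rfl⟩
  choose! p hp using hW2
  have hGW : commutator G ≤ Subgroup.closure W := by
    rw [commutator_def, Subgroup.commutator_le]
    intro g _ h _
    have hL : ⁅(⊤ : Subgroup G), Subgroup.zpowers h⁆ ∈ I := ⟨h, rfl⟩
    have h1 : ⁅g, h⁆ ∈ ⁅(⊤ : Subgroup G), Subgroup.zpowers h⁆ :=
      Subgroup.commutator_mem_commutator (Subgroup.mem_top g) (Subgroup.mem_zpowers h)
    rw [hr _ hL] at h1
    refine Subgroup.closure_mono ?_ (comm_zpowers _ h1)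
    intro z hz
    exact Set.mem_biUnion hL hz
  let F : Set G := (fun z => (p z).1) '' W ∪ (fun z => (p z).2) '' W
  have hF : F.Finite := (hW.image _).union (hW.image _)
  have hfin := fg_comm_fin hloc hG (Subgroup.closure F)
    ((Subgroup.fg_iff _).2 ⟨F, rfl, hF⟩)
  have hle : commutator G ≤ ⁅Subgroup.closure F, Subgroup.closure F⁆ := by
    refine hGW.trans ((Subgroup.closure_le _).2 ?_)
    intro z hz
    rw [← hp z hz]
    exact Subgroup.commutator_mem_commutator
      (Subgroup.subset_closure (Or.inl ⟨z, hz, rfl⟩)) (Subgroup.subset_closure (Or.inr ⟨z, hz, rfl⟩))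
  have hle2 : ⁅commutator G, commutator G⁆ ≤ ⁅Subgroup.closure F, Subgroup.closure F⁆ :=
    (Subgroup.commutator_mono le_top le_top).trans hle
  exact ((Set.toFinite ((⁅Subgroup.closure F, Subgroup.closure F⁆ : Subgroup G) : Set G)).subset hle2).to_subtype
end
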